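/- Let α ∈ (0,1) be a Liouville number. For every r ∈ ℕ there exists a lift f of an orientation-preserving C^∞ circle diffeomorphism with rotation number ρ(f) = α such that d_r(f, R_α) < 2^{−r} and the circle diffeomorphism induced by f admits an invariant σ-finite infinite Borel measure equivalent to the Lebesgue measure m but admits no invariant finite Borel measure equivalent to m (i.e. it is of type II_∞). -/

import Mathlib

noncomputable section
open MeasureTheory Filter Topology

/-- A lift of an orientation-preserving `C^∞` circle diffeomorphism: a `C^∞` map
`f : ℝ → ℝ` with `f (x+1) = f x + 1` and everywhere positive derivative. -/
def IsCircleDiffeoLift (f : ℝ → ℝ) : Prop :=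
  ContDiff ℝ (⊤ : ℕ∞) f ∧ (∀ x : ℝ, f (x + 1) = f x + 1) ∧ ∀ x : ℝ, 0 < deriv f x

/-- The `C^r` norm `‖φ‖_r = max_{0 ≤ i ≤ r} sup_x |φ^{(i)}(x)|`. -/
def CrNorm (r : ℕ) (φ : ℝ → ℝ) : ℝ :=
  (Finset.range (r + 1)).sup' (Finset.nonempty_range_iff.mpr r.succ_ne_zero)
    fun i => ⨆ x : ℝ, |iteratedDeriv i φ x|

/-- `d_r(f, g) = max {‖f - g‖_r, ‖f⁻¹ - g⁻¹‖_r}`. -/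
def liftDist (r : ℕ) (f g : ℝ → ℝ) : ℝ :=
  max (CrNorm r (fun x => f x - g x))
    (CrNorm r (fun x => Function.invFun f x - Function.invFun g x))

/-- `|f|_r = max {‖f - id‖_r, ‖f⁻¹ - id‖_r, 1}`. -/
def liftNorm (r : ℕ) (f : ℝ → ℝ) : ℝ :=
  max (max (CrNorm r (fun x => f x - x)) (CrNorm r (fun x => Function.invFun f x - x))) 1

/-- The lift `x ↦ x + a` of the rotation by `a`. -/
def RotLift (a : ℝ) : ℝ → ℝ := fun x => x + a

/-- The rotation number of the circle diffeomorphism induced by the lift `f` equals `a`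
(mod 1): the translation number `lim (fⁿ(0) - 0)/n` equals `a + k` for some integer `k`. -/
def HasRotationNumber (f : ℝ → ℝ) (a : ℝ) : Prop :=
  ∃ k : ℤ, Tendsto (fun n : ℕ => f^[n] 0 / (n : ℝ)) atTop (nhds (a + k))

/-- The lift of the `i`-th iterate (`i ∈ ℤ`) of the circle diffeomorphism induced by `f`. -/
def zpowLift (f : ℝ → ℝ) : ℤ → ℝ → ℝ := fun i =>
  if 0 ≤ i then f^[i.toNat] else (Function.invFun f)^[(-i).toNat]

/-- The ratio set of a circle diffeomorphism, described through the family `Fz i` of its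
iterates (`i ∈ ℤ`) and the family `D i` of the derivatives of its iterates: `t ≥ 0` lies in
the ratio set iff for every Borel `A` of positive Haar measure and every `ε > 0` there are a
Borel `B ⊆ A` of positive measure and `i ∈ ℤ` with `Fz i '' B ⊆ A` and `|D i x - t| < ε`
on `B`. -/
def ratioSet (Fz : ℤ → UnitAddCircle → UnitAddCircle) (D : ℤ → UnitAddCircle → ℝ) : Set ℝ :=
  {t : ℝ | 0 ≤ t ∧ ∀ A : Set UnitAddCircle, MeasurableSet A → 0 < volume A →
    ∀ ε : ℝ, 0 < ε → ∃ B : Set UnitAddCircle, MeasurableSet B ∧ B ⊆ A ∧ 0 < volume B ∧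
      ∃ i : ℤ, Fz i '' B ⊆ A ∧ ∀ x ∈ B, |D i x - t| < ε}

/-- A lift of an orientation-preserving `C¹` circle diffeomorphism. -/
def IsC1CircleLift (f : ℝ → ℝ) : Prop :=
  ContDiff ℝ 1 f ∧ (∀ x : ℝ, f (x + 1) = f x + 1) ∧ ∀ x : ℝ, 0 < deriv f x

/-- The derivatives of `f` of orders `1, …, N` grow at most geometrically with ratio `K`. -/
def HasDerivGrowth (f : ℝ → ℝ) (K : ℝ) (N : ℕ) : Prop :=
  ∀ i, 1 ≤ i → i ≤ N → ∀ x, |iteratedDeriv i f x| ≤ K ^ i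

lemma HasDerivGrowth.mono {f : ℝ → ℝ} {K L : ℝ} {N : ℕ} (hf : HasDerivGrowth f K N)
    (hK : 0 ≤ K) (hKL : K ≤ L) : HasDerivGrowth f L N :=
  fun i h1 h2 x => (hf i h1 h2 x).trans (by gcongr)

lemma abs_iteratedDeriv_comp_le {g f : ℝ → ℝ} (hg : ContDiff ℝ (⊤ : ℕ∞) g)
    (hf : ContDiff ℝ (⊤ : ℕ∞) f) {n : ℕ} (x : ℝ) {C D : ℝ}
    (hC : ∀ i ≤ n, |iteratedDeriv i g (f x)| ≤ C)
    (hD : ∀ i, 1 ≤ i → i ≤ n → |iteratedDeriv i f x| ≤ D ^ i) :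
    |iteratedDeriv n (fun y => g (f y)) x| ≤ n.factorial * C * D ^ n := by
  have := norm_iteratedFDeriv_comp_le (n := n) hg hf (by exact_mod_cast le_top) x (C := C) (D := D)
    (fun i hi => by rw [norm_iteratedFDeriv_eq_norm_iteratedDeriv]; exact hC i hi)
    (fun i hi hi' => by rw [norm_iteratedFDeriv_eq_norm_iteratedDeriv]; exact hD i hi hi')
  rwa [norm_iteratedFDeriv_eq_norm_iteratedDeriv] at this

lemma iteratedDeriv_fun_sub_const {f : ℝ → ℝ} {n : ℕ} (hn : 0 < n) (c : ℝ) :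
    iteratedDeriv n (fun y => f y - c) = iteratedDeriv n f := by
  obtain ⟨m, rfl⟩ : ∃ m, n = m + 1 := ⟨n - 1, by omega⟩
  rw [iteratedDeriv_succ', iteratedDeriv_succ']
  congr 1
  ext y
  simp

lemma HasDerivGrowth.comp {g f : ℝ → ℝ} (hg : ContDiff ℝ (⊤ : ℕ∞) g)
    (hf : ContDiff ℝ (⊤ : ℕ∞) f) {K L : ℝ} {N : ℕ} (hK : 1 ≤ K) (hL : 1 ≤ L)
    (hgK : HasDerivGrowth g K N) (hfL : HasDerivGrowth f L N) :
    HasDerivGrowth (fun y => g (f y)) (N.factorial * K * L) N := by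
  intro i hi hiN x
  have h1 : iteratedDeriv i (fun y => g (f y)) x
      = iteratedDeriv i (fun y => (fun z => g z - g (f x)) (f y)) x := by
    rw [iteratedDeriv_fun_sub_const (f := fun y => g (f y)) hi]
  rw [h1]
  refine (abs_iteratedDeriv_comp_le (hg.sub contDiff_const) hf x (C := K ^ i) (D := L) ?_
    (fun j hj hji => hfL j hj (hji.trans hiN) x)).trans ?_
  · intro j hj
    rcases Nat.eq_zero_or_pos j with rfl | hj0
    · simp; positivity
    · rw [iteratedDeriv_fun_sub_const hj0]
      exact (hgK j hj0 (hj.trans hiN) _).trans (pow_le_pow_right₀ hK hj)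
  · have h2 : (i.factorial : ℝ) ≤ N.factorial := by exact_mod_cast Nat.factorial_le hiN
    have h3 : (1 : ℝ) ≤ N.factorial := by exact_mod_cast Nat.one_le_iff_ne_zero.2 N.factorial_ne_zero
    have h4 : (i.factorial : ℝ) ≤ (N.factorial : ℝ) ^ i :=
      h2.trans (le_self_pow₀ h3 (by omega))
    rw [mul_pow, mul_pow]
    gcongr

lemma HasDerivGrowth.rescale {f : ℝ → ℝ} (hf : ContDiff ℝ (⊤ : ℕ∞) f) {K : ℝ} {N : ℕ}
    (hfK : HasDerivGrowth f K N) {q : ℝ} (hq : 1 ≤ q) :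
    HasDerivGrowth (fun x => f (q * x) / q) (K * q) N := by
  intro i hi hiN x
  have h1 : iteratedDeriv i (fun x => f (q * x) / q) x
      = q ^ i * iteratedDeriv i f (q * x) / q := by
    simp_rw [div_eq_inv_mul]
    rw [iteratedDeriv_const_mul_field, iteratedDeriv_comp_const_mul (hf.of_le (by exact_mod_cast le_top))]
  rw [h1, abs_div, abs_mul, abs_of_nonneg (by positivity : 0 ≤ q ^ i), abs_of_nonneg (by positivity : 0 ≤ q)]
  refine (div_le_self (by positivity) hq).trans ?_
  rw [mul_pow, mul_comm]
  have := hfK i hi hiN (q * x)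
  gcongr

lemma periodic_iteratedDeriv {f : ℝ → ℝ} (hper : ∀ x, f (x + 1) = f x + 1) {i : ℕ} (hi : 1 ≤ i) :
    Function.Periodic (iteratedDeriv i f) 1 := by
  intro x
  have h1 := congrFun (iteratedDeriv_comp_add_const i f 1) x
  rw [← h1]
  have : (fun z => f (z + 1)) = fun z => f z - (-1) := by ext z; rw [hper]; ring
  rw [this, iteratedDeriv_fun_sub_const hi]

lemma exists_bound_of_periodic {f : ℝ → ℝ} (hf : Continuous f) (hper : Function.Periodic f 1) :
    ∃ C, 0 ≤ C ∧ ∀ x, |f x| ≤ C := by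
  obtain ⟨C, hC⟩ := (hper.isBounded_of_continuous one_ne_zero hf).exists_norm_le
  exact ⟨C, (norm_nonneg _).trans (hC _ ⟨0, rfl⟩), fun x => hC _ ⟨x, rfl⟩⟩

lemma exists_hasDerivGrowth {f : ℝ → ℝ} (hf : ContDiff ℝ (⊤ : ℕ∞) f)
    (hper : ∀ x, f (x + 1) = f x + 1) (N : ℕ) : ∃ K, 1 ≤ K ∧ HasDerivGrowth f K N := by
  have key : ∀ i, ∃ C, 0 ≤ C ∧ (1 ≤ i → ∀ x, |iteratedDeriv i f x| ≤ C) := by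
    intro i
    by_cases hi : 1 ≤ i
    · obtain ⟨C, h0, hC⟩ := exists_bound_of_periodic
        (hf.continuous_iteratedDeriv i (by exact_mod_cast le_top)) (periodic_iteratedDeriv hper hi)
      exact ⟨C, h0, fun _ => hC⟩
    · exact ⟨0, le_rfl, fun h => absurd h hi⟩
  choose C h0 hC using key
  have hs : 0 ≤ ∑ j ∈ Finset.range (N + 1), C j := Finset.sum_nonneg fun j _ => h0 j
  refine ⟨1 + ∑ j ∈ Finset.range (N + 1), C j, by linarith, fun i hi hiN x => (hC i hi x).trans ?_⟩
  have h1 : C i ≤ ∑ j ∈ Finset.range (N + 1), C j :=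
    Finset.single_le_sum (fun j _ => h0 j) (Finset.mem_range.2 (by omega))
  exact (h1.trans (by linarith)).trans (le_self_pow₀ (by linarith) (by omega))

/-- Lifts of smooth circle diffeomorphisms fixing the origin. -/
structure IsNormalizedLift (h : ℝ ≃ ℝ) : Prop where
  contDiff : ContDiff ℝ (⊤ : ℕ∞) h
  contDiff_symm : ContDiff ℝ (⊤ : ℕ∞) h.symm
  strictMono : StrictMono h
  map_add_one : ∀ x, h (x + 1) = h x + 1
  map_zero : h 0 = 0

/-- The conjugate by `h` of the translation by `t`. -/
def conjRot (h : ℝ ≃ ℝ) (t x : ℝ) : ℝ := h (h.symm x + t)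

/-- The lift of `h` through the `q`-fold covering of the circle. -/
def coverLift (q : ℕ) (h : ℝ ≃ ℝ) (hq : (q : ℝ) ≠ 0) : ℝ ≃ ℝ where
  toFun x := h (q * x) / q
  invFun x := h.symm (q * x) / q
  left_inv x := by simp [mul_div_cancel₀ _ hq, hq]
  right_inv x := by simp [mul_div_cancel₀ _ hq, hq]

namespace IsNormalizedLift

variable {h a : ℝ ≃ ℝ}

lemma symm (hh : IsNormalizedLift h) : IsNormalizedLift h.symm where
  contDiff := hh.contDiff_symm
  contDiff_symm := hh.contDiff
  strictMono x y hxy := by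
    by_contra! hc
    have := hh.strictMono.monotone hc
    simp only [Equiv.apply_symm_apply] at this
    linarith
  map_add_one x := by
    rw [Equiv.symm_apply_eq, hh.map_add_one, Equiv.apply_symm_apply]
  map_zero := by rw [Equiv.symm_apply_eq, hh.map_zero]

lemma refl : IsNormalizedLift (Equiv.refl ℝ) where
  contDiff := contDiff_id
  contDiff_symm := contDiff_id
  strictMono := strictMono_id
  map_add_one _ := rfl
  map_zero := rfl

lemma trans (ha : IsNormalizedLift a) (hh : IsNormalizedLift h) :
    IsNormalizedLift (a.trans h) where
  contDiff := hh.contDiff.comp ha.contDiff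
  contDiff_symm := ha.contDiff_symm.comp hh.contDiff_symm
  strictMono := hh.strictMono.comp ha.strictMono
  map_add_one x := by simp [ha.map_add_one, hh.map_add_one]
  map_zero := by simp [ha.map_zero, hh.map_zero]

lemma map_add_int (hh : IsNormalizedLift h) (x : ℝ) (m : ℤ) : h (x + m) = h x + m := by
  have hper : Function.Periodic (fun x => h x - x) 1 := fun x => by
    simp [hh.map_add_one]
  have := hper.int_mul m x
  simp only [mul_one] at this
  linarith

lemma map_int (hh : IsNormalizedLift h) (m : ℤ) : h m = m := by
  simpa [hh.map_zero] using hh.map_add_int 0 m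

lemma coverLift (hh : IsNormalizedLift h) (q : ℕ) (hq : (q : ℝ) ≠ 0) :
    IsNormalizedLift (coverLift q h hq) where
  contDiff := (hh.contDiff.comp (contDiff_const.mul contDiff_id)).div_const _
  contDiff_symm := (hh.contDiff_symm.comp (contDiff_const.mul contDiff_id)).div_const _
  strictMono x y hxy := by
    have : (0 : ℝ) < q := lt_of_le_of_ne (Nat.cast_nonneg q) hq.symm
    exact div_lt_div_of_pos_right (hh.strictMono (by gcongr)) this
  map_add_one x := by
    have := hh.map_add_int (q * x) q
    simp only [Int.cast_natCast] at this
    simp [_root_.coverLift, mul_add, this, add_div, hq]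
  map_zero := by simp [_root_.coverLift, hh.map_zero]

lemma contDiff_conjRot (hh : IsNormalizedLift h) (t : ℝ) : ContDiff ℝ (⊤ : ℕ∞) (conjRot h t) :=
  hh.contDiff.comp (hh.contDiff_symm.add contDiff_const)

lemma conjRot_add_one (hh : IsNormalizedLift h) (t x : ℝ) :
    conjRot h t (x + 1) = conjRot h t x + 1 := by
  rw [conjRot, hh.symm.map_add_one, add_right_comm, hh.map_add_one, conjRot]

lemma abs_sub_le_one (hh : IsNormalizedLift h) (x : ℝ) : |h x - x| ≤ 1 := by
  have h1 := hh.strictMono.monotone (Int.floor_le x)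
  have h2 := hh.strictMono.monotone (Int.lt_floor_add_one x).le
  rw [hh.map_add_one, hh.map_int] at h2
  rw [hh.map_int] at h1
  rw [abs_le]
  constructor <;> linarith [Int.floor_le x, Int.lt_floor_add_one x]

lemma deriv_pos (hh : IsNormalizedLift h) (x : ℝ) : 0 < deriv h x := by
  have hd := (hh.contDiff.differentiable (by simp) x).hasDerivAt
  have hd' := (hh.contDiff_symm.differentiable (by simp) (h x)).hasDerivAt
  have h1 := hd'.comp x hd
  have h2 : (h.symm ∘ h) = id := by ext; simp
  rw [h2] at h1
  have h3 := h1.unique (hasDerivAt_id x)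
  refine lt_of_le_of_ne (hh.strictMono.monotone.deriv_nonneg) fun h0 => ?_
  rw [← h0] at h3
  simp at h3

lemma conjRot_iterate (h : ℝ ≃ ℝ) (t x : ℝ) (i : ℕ) :
    (conjRot h t)^[i] x = h (h.symm x + i * t) := by
  induction i with
  | zero => simp
  | succ i ih =>
    rw [Function.iterate_succ_apply', ih, conjRot, Equiv.symm_apply_apply]
    push_cast
    ring_nf

end IsNormalizedLift

lemma abs_iteratedDeriv_conjRot_sub_le {h : ℝ ≃ ℝ} (hh : IsNormalizedLift h) {K : ℝ} {N : ℕ}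
    (hK : 1 ≤ K) (h1 : HasDerivGrowth h K (N + 1)) (h2 : HasDerivGrowth h.symm K (N + 1))
    {k : ℕ} (hk : k ≤ N) (t s x : ℝ) :
    |iteratedDeriv k (fun x => conjRot h t x - conjRot h s x) x|
      ≤ N.factorial * K ^ (2 * N + 1) * |t - s| := by
  have hsm : ∀ c : ℝ, ContDiff ℝ (⊤ : ℕ∞) fun z => h (z + c) := fun c =>
    hh.contDiff.comp (contDiff_id.add contDiff_const)
  have hG : ∀ i ≤ k, ∀ z, |iteratedDeriv i (fun z => h (z + t) - h (z + s)) z|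
      ≤ K ^ (N + 1) * |t - s| := by
    intro i hi z
    have e : iteratedDeriv i (fun z => h (z + t) - h (z + s)) z
        = iteratedDeriv i h (z + t) - iteratedDeriv i h (z + s) := by
      have := iteratedDeriv_sub (n := i) (x := z)
        ((hsm t).of_le (by exact_mod_cast le_top)).contDiffAt
        ((hsm s).of_le (by exact_mod_cast le_top)).contDiffAt
      rw [iteratedDeriv_comp_add_const, iteratedDeriv_comp_add_const] at this
      exact this
    rw [e]
    have hdiff : Differentiable ℝ (iteratedDeriv i h) :=
      hh.contDiff.differentiable_iteratedDeriv i (by exact_mod_cast WithTop.coe_lt_top i)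
    have := Convex.norm_image_sub_le_of_norm_deriv_le (f := iteratedDeriv i h) (s := Set.univ)
      (x := z + s) (y := z + t) (C := K ^ (N + 1)) (fun y _ => hdiff y) (fun y _ => by
        rw [← iteratedDeriv_succ]
        exact (h1 (i + 1) (by omega) (by omega) y).trans (pow_le_pow_right₀ hK (by omega)))
      convex_univ trivial trivial
    simpa [Real.norm_eq_abs] using this
  have := abs_iteratedDeriv_comp_le ((hsm t).sub (hsm s)) hh.contDiff_symm (n := k) x
    (fun i hi => hG i hi _) (fun i hi hi' => h2 i hi (by omega) x)
  refine this.trans ?_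
  have hf : (k.factorial : ℝ) ≤ N.factorial := by exact_mod_cast Nat.factorial_le hk
  have hp : K ^ k ≤ K ^ N := pow_le_pow_right₀ hK hk
  calc (k.factorial : ℝ) * (K ^ (N + 1) * |t - s|) * K ^ k
      ≤ N.factorial * (K ^ (N + 1) * |t - s|) * K ^ N := by gcongr
    _ = _ := by ring

lemma conjRot_coverLift_rat {h a : ℝ ≃ ℝ} (ha : IsNormalizedLift a) {q : ℕ} (hq : (q : ℝ) ≠ 0)
    (p : ℤ) : conjRot ((coverLift q a hq).trans h) (p / q) = conjRot h (p / q) := by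
  ext x
  have : coverLift q a hq ((coverLift q a hq).symm (h.symm x) + p / q) = h.symm x + p / q := by
    simp [coverLift, mul_add, mul_div_cancel₀ _ hq, ha.map_add_int, add_div, hq]
  simp [conjRot, this]

lemma exists_growth_pair {h : ℝ ≃ ℝ} (hh : IsNormalizedLift h) (N : ℕ) :
    ∃ K, 1 ≤ K ∧ HasDerivGrowth h K N ∧ HasDerivGrowth h.symm K N := by
  obtain ⟨K, hK, h1⟩ := exists_hasDerivGrowth hh.contDiff hh.map_add_one N
  obtain ⟨L, hL, h2⟩ := exists_hasDerivGrowth hh.contDiff_symm hh.symm.map_add_one N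
  exact ⟨max K L, hK.trans (le_max_left _ _), h1.mono (by linarith) (le_max_left _ _),
    h2.mono (by linarith) (le_max_right _ _)⟩

lemma exists_coverLift_close {α : ℝ} (hα : Liouville α) {h a : ℝ ≃ ℝ} (hh : IsNormalizedLift h)
    (ha : IsNormalizedLift a) (N : ℕ) {η : ℝ} (hη : 0 < η) :
    ∃ q : ℕ, ∃ hq : (q : ℝ) ≠ 0, ∀ t, t = α ∨ t = -α → ∀ k ≤ N, ∀ x,
      |iteratedDeriv k
        (fun x => conjRot ((coverLift q a hq).trans h) t x - conjRot h t x) x| ≤ η := by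
  obtain ⟨K, hK, hK1, hK2⟩ := exists_growth_pair hh (N + 1)
  obtain ⟨L, hL, hL1, hL2⟩ := exists_growth_pair ha (N + 1)
  set M : ℝ := (N + 1).factorial * K * L with hM
  have hfac : (1 : ℝ) ≤ (N + 1).factorial := by
    exact_mod_cast Nat.one_le_iff_ne_zero.2 (N + 1).factorial_ne_zero
  have hM1 : 1 ≤ M := one_le_mul_of_one_le_of_one_le (one_le_mul_of_one_le_of_one_le hfac hK) hL
  have hKM : K ≤ M := by
    have : 1 * K * 1 ≤ M := by rw [hM]; gcongr
    simpa using this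
  set C : ℝ := 2 * (N.factorial * M ^ (2 * N + 1)) with hC
  have hC0 : 0 < C := by positivity
  obtain ⟨j, hj⟩ := exists_pow_lt_of_lt_one (div_pos hη hC0) (show (1 / 2 : ℝ) < 1 by norm_num)
  obtain ⟨p, b, hb, -, hlt⟩ := hα (2 * N + 1 + j)
  obtain ⟨q, rfl⟩ := Int.eq_ofNat_of_zero_le (show 0 ≤ b by omega)
  have hq2 : (2 : ℝ) ≤ q := by exact_mod_cast (show 2 ≤ q by omega)
  have hq : (q : ℝ) ≠ 0 := by linarith
  simp only [Int.cast_natCast] at hlt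
  refine ⟨q, hq, fun t ht k hk x => ?_⟩
  obtain ⟨p', hp'⟩ : ∃ p' : ℤ, |t - p' / q| < 1 / (q : ℝ) ^ (2 * N + 1 + j) := by
    rcases ht with rfl | rfl
    · exact ⟨p, hlt⟩
    · refine ⟨-p, ?_⟩
      rw [← abs_neg] at hlt
      convert hlt using 2
      push_cast
      ring
  set H := (coverLift q a hq).trans h with hH
  have hHn : IsNormalizedLift H := (ha.coverLift q hq).trans hh
  have hq1 : (1 : ℝ) ≤ q := by linarith
  have hLq : 1 ≤ L * q := one_le_mul_of_one_le_of_one_le hL hq1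
  have e1 : HasDerivGrowth H (M * q) (N + 1) := by
    have := HasDerivGrowth.comp hh.contDiff (ha.coverLift q hq).contDiff hK hLq hK1
      (hL1.rescale ha.contDiff hq1)
    have e : M * q = (N + 1).factorial * K * (L * q) := by rw [hM]; ring
    rw [e]; exact this
  have e2 : HasDerivGrowth H.symm (M * q) (N + 1) := by
    have := HasDerivGrowth.comp (ha.coverLift q hq).contDiff_symm hh.contDiff_symm hLq hK
      (hL2.rescale ha.contDiff_symm hq1) hK2
    have e : M * q = (N + 1).factorial * (L * q) * K := by rw [hM]; ring
    rw [e]; exact this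
  have hKMq : K ≤ M * q := hKM.trans (le_mul_of_one_le_right (by linarith) hq1)
  have hMq : 1 ≤ M * q := hK.trans hKMq
  have b1 := abs_iteratedDeriv_conjRot_sub_le hHn hMq e1 e2 hk t (p' / q) x
  have b2 := abs_iteratedDeriv_conjRot_sub_le hh hMq (hK1.mono (by linarith) hKMq)
    (hK2.mono (by linarith) hKMq) hk t (p' / q) x
  have hs := conjRot_coverLift_rat (h := h) ha hq p'
  have hsplit : (fun x => conjRot H t x - conjRot h t x)
      = (fun x => conjRot H t x - conjRot H (p' / q) x)
        - fun x => conjRot h t x - conjRot h (p' / q) x := by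
    ext x
    simp only [Pi.sub_apply]
    rw [hH, hs]
    ring
  rw [hsplit, iteratedDeriv_sub]
  rotate_left
  · exact (((hHn.contDiff_conjRot t).sub (hHn.contDiff_conjRot _)).of_le
      (by exact_mod_cast le_top)).contDiffAt
  · exact (((hh.contDiff_conjRot t).sub (hh.contDiff_conjRot _)).of_le
      (by exact_mod_cast le_top)).contDiffAt
  have hqp : (0 : ℝ) < q := by linarith
  calc _ ≤ _ := abs_sub _ _
    _ ≤ N.factorial * (M * q) ^ (2 * N + 1) * |t - p' / q|
        + N.factorial * (M * q) ^ (2 * N + 1) * |t - p' / q| := add_le_add b1 b2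
    _ = C * (q ^ (2 * N + 1) * |t - p' / q|) := by rw [hC]; ring
    _ ≤ C * (q ^ (2 * N + 1) * (1 / (q : ℝ) ^ (2 * N + 1 + j))) := by gcongr
    _ = C * (1 / q) ^ j := by
        rw [one_div_pow, pow_add _ _ j]; field_simp
    _ ≤ C * (1 / 2) ^ j := by gcongr
    _ ≤ C * (η / C) := by gcongr
    _ = η := by field_simp

/-- A lift of degree one equal to `⌊x⌋` except on the intervals `(n - ε, n)`. -/
def smoothStair (ε x : ℝ) : ℝ := ⌊x⌋ + Real.smoothTransition ((Int.fract x - (1 - ε)) / ε)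

lemma smoothStair_eq {ε x : ℝ} (hε : 0 < ε) (n : ℤ) (h1 : n ≤ x) (h2 : x ≤ n + (2 - ε)) :
    smoothStair ε x = n + Real.smoothTransition ((x - n - (1 - ε)) / ε) := by
  rcases lt_or_ge x (n + 1) with h | h
  · have : ⌊x⌋ = n := Int.floor_eq_iff.2 ⟨h1, h⟩
    rw [smoothStair, Int.fract, this]
  · have : ⌊x⌋ = n + 1 := Int.floor_eq_iff.2 ⟨by push_cast; linarith, by push_cast; linarith⟩
    rw [smoothStair, Int.fract, this, Real.smoothTransition.zero_of_nonpos,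
      Real.smoothTransition.one_of_one_le]
    · push_cast; ring
    · rw [le_div_iff₀ hε]; linarith
    · apply div_nonpos_of_nonpos_of_nonneg _ hε.le
      push_cast; linarith

lemma contDiff_smoothStair {ε : ℝ} (hε : 0 < ε) (hε1 : ε < 1) :
    ContDiff ℝ (⊤ : ℕ∞) (smoothStair ε) := by
  rw [contDiff_iff_contDiffAt]
  intro x
  have h1 : ((⌈x⌉ - 1 : ℤ) : ℝ) < x := by push_cast; linarith [Int.ceil_lt_add_one x]
  have h2 : x < ((⌈x⌉ - 1 : ℤ) : ℝ) + (2 - ε) := by push_cast; linarith [Int.le_ceil x]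
  have : smoothStair ε =ᶠ[𝓝 x] fun y => ((⌈x⌉ - 1 : ℤ) : ℝ)
      + Real.smoothTransition ((y - ((⌈x⌉ - 1 : ℤ) : ℝ) - (1 - ε)) / ε) := by
    filter_upwards [Ioo_mem_nhds h1 h2] with y hy
    exact smoothStair_eq hε _ hy.1.le hy.2.le
  refine ContDiffAt.congr_of_eventuallyEq ?_ this
  refine ContDiff.contDiffAt (contDiff_const.add (Real.smoothTransition.contDiff.comp ?_))
  exact ((contDiff_id.sub contDiff_const).sub contDiff_const).div_const _

lemma monotone_smoothStair {ε : ℝ} (hε : 0 < ε) : Monotone (smoothStair ε) := by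
  intro x y hxy
  rcases (Int.floor_mono hxy).eq_or_lt with h | h
  · have : Int.fract x ≤ Int.fract y := by rw [Int.fract, Int.fract, h]; linarith
    rw [smoothStair, smoothStair, h]
    have := Real.smoothTransition.monotone
      (show (Int.fract x - (1 - ε)) / ε ≤ (Int.fract y - (1 - ε)) / ε by gcongr)
    linarith
  · have h' : (⌊x⌋ : ℝ) + 1 ≤ ⌊y⌋ := by exact_mod_cast h
    rw [smoothStair, smoothStair]
    linarith [Real.smoothTransition.le_one ((Int.fract x - (1 - ε)) / ε),
      Real.smoothTransition.nonneg ((Int.fract y - (1 - ε)) / ε)]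

lemma exists_contracting_lift {ε : ℝ} (hε : 0 < ε) (hε1 : ε < 1) :
    ∃ a : ℝ ≃ ℝ, IsNormalizedLift a ∧ ∀ m : ℤ, ∀ y ∈ Set.Icc (m : ℝ) (m + 1 - ε),
      a.symm y = m + (y - m) / 2 ∧ deriv a.symm y = 1 / 2 := by
  set b : ℝ → ℝ := fun x => x / 2 + smoothStair ε x / 2 with hb
  have hbs : ContDiff ℝ (⊤ : ℕ∞) b :=
    (contDiff_id.div_const _).add ((contDiff_smoothStair hε hε1).div_const _)
  have hmono : StrictMono b := fun x y hxy => by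
    have := monotone_smoothStair hε hxy.le
    simp only [hb]; linarith
  have hval : ∀ m : ℤ, ∀ y ∈ Set.Icc (m : ℝ) (m + 1 - ε), b y = m + (y - m) / 2 := by
    intro m y hy
    have := smoothStair_eq hε m hy.1 (by linarith [hy.2])
    rw [Real.smoothTransition.zero_of_nonpos] at this
    · simp only [hb, this]; ring
    · exact div_nonpos_of_nonpos_of_nonneg (by linarith [hy.2]) hε.le
  have hadd : ∀ x, b (x + 1) = b x + 1 := fun x => by
    simp only [hb, smoothStair, Int.fract_add_one, Int.floor_add_one]; push_cast; ring
  have hstair : ∀ x, |smoothStair ε x - x| ≤ 1 := fun x => by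
    rw [smoothStair, abs_le]
    have h0 := Real.smoothTransition.le_one ((Int.fract x - (1 - ε)) / ε)
    have h1 := Real.smoothTransition.nonneg ((Int.fract x - (1 - ε)) / ε)
    constructor <;> linarith [Int.floor_le x, Int.lt_floor_add_one x]
  have hclose : ∀ x, |b x - x| ≤ 1 := fun x => by
    have h1 := abs_le.1 (hstair x)
    simp only [hb, abs_le]
    constructor <;> linarith [h1.1, h1.2]
  have hsurj : Function.Surjective b := by
    refine hbs.continuous.surjective ?_ ?_
    · refine tendsto_atTop_mono (fun x => ?_) (tendsto_atTop_add_const_right _ (-1) tendsto_id)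
      have := (abs_le.1 (hclose x)).1
      simp only [id]; linarith
    · refine tendsto_atBot_mono (fun x => ?_) (tendsto_atBot_add_const_right _ 1 tendsto_id)
      have := (abs_le.1 (hclose x)).2
      simp only [id]; linarith
  have hderiv : ∀ x, deriv b x = 1 / 2 + deriv (smoothStair ε) x / 2 := fun x => by
    have hd := ((contDiff_smoothStair hε hε1).differentiable (by simp) x).hasDerivAt
    exact (((hasDerivAt_id x).div_const 2).add (hd.div_const 2)).deriv
  have hne : ∀ x, deriv b x ≠ 0 := fun x => by
    rw [hderiv]
    have := (monotone_smoothStair hε).deriv_nonneg (x := x)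
    positivity
  set e : ℝ ≃o ℝ := hmono.orderIsoOfSurjective b hsurj with he
  have hsymm : ContDiff ℝ (⊤ : ℕ∞) e.toHomeomorph.symm := by
    refine e.toHomeomorph.contDiff_symm_deriv hne (fun x => ?_) hbs
    exact (hbs.differentiable (by simp) x).hasDerivAt
  have hN : IsNormalizedLift e.toEquiv :=
    { contDiff := hbs
      contDiff_symm := hsymm
      strictMono := hmono
      map_add_one := hadd
      map_zero := by
        have := hval 0 0 (by simp; linarith)
        simp only [Int.cast_zero, sub_zero, zero_div, add_zero] at this
        exact this }
  refine ⟨e.toEquiv.symm, hN.symm, fun m y hy => ⟨hval m y hy, ?_⟩⟩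
  change deriv b y = 1 / 2
  have hclos : Set.EqOn (deriv b) (fun _ => 1 / 2) (closure (Set.Ioo (m : ℝ) (m + 1 - ε))) := by
    refine Set.EqOn.closure (fun z hz => ?_) (hbs.continuous_deriv (by simp)) continuous_const
    have : b =ᶠ[𝓝 z] fun y => m + (y - m) / 2 := by
      filter_upwards [Ioo_mem_nhds hz.1 hz.2] with w hw
      exact hval m w ⟨hw.1.le, hw.2.le⟩
    rw [this.deriv_eq]
    exact ((((hasDerivAt_id z).sub_const (m : ℝ)).div_const 2).const_add (m : ℝ)).deriv
  rw [closure_Ioo (by linarith)] at hclos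
  exact hclos hy

lemma exists_nat_mul_sub_int_mem_Ioo {β lo hi : ℝ} (hβ : Irrational β) (h : lo < hi) :
    ∃ n : ℕ, ∃ l : ℤ, n * β - l ∈ Set.Ioo lo hi := by
  have hd : DenseRange (fun n : ℕ => n • (β : UnitAddCircle)) := by
    rw [← denseRange_zsmul_iff_nsmul, AddCircle.denseRange_zsmul_coe_iff]
    simpa using hβ
  have ho : IsOpen (((↑) : ℝ → UnitAddCircle) '' Set.Ioo lo hi) :=
    QuotientAddGroup.isOpenMap_coe _ isOpen_Ioo
  obtain ⟨n, θ, hθ, he⟩ := hd.exists_mem_open ho ((Set.nonempty_Ioo.2 h).image _)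
  have h0 : ((n * β - θ : ℝ) : UnitAddCircle) = 0 := by
    rw [AddCircle.coe_sub, he, sub_eq_zero, ← nsmul_eq_mul, AddCircle.coe_nsmul]
  obtain ⟨l, hl⟩ := (AddCircle.coe_eq_zero_iff 1).1 h0
  refine ⟨n, l, ?_⟩
  have : n * β - l = θ := by
    simp only [zsmul_eq_mul, mul_one] at hl
    linarith
  rwa [this]

lemma exists_iterate_close {f : ℝ → ℝ} (hf : UniformContinuous f) (i : ℕ) :
    ∀ δ > 0, ∃ η > 0, ∀ g : ℝ → ℝ, (∀ x, |g x - f x| ≤ η) → ∀ x, |g^[i] x - f^[i] x| ≤ δ := by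
  induction i with
  | zero => exact fun δ hδ => ⟨1, one_pos, fun g _ x => by simpa using hδ.le⟩
  | succ i ih =>
    intro δ hδ
    obtain ⟨ρ, hρ, hfρ⟩ := Metric.uniformContinuous_iff.1 hf (δ / 2) (half_pos hδ)
    obtain ⟨η, hη, H⟩ := ih (ρ / 2) (half_pos hρ)
    refine ⟨min η (δ / 2), lt_min hη (half_pos hδ), fun g hg x => ?_⟩
    have h1 := H g (fun x => (hg x).trans (min_le_left _ _)) x
    have h2 := hfρ (a := g^[i] x) (b := f^[i] x) (by rw [Real.dist_eq]; linarith)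
    have h3 := (hg (g^[i] x)).trans (min_le_right _ _)
    rw [Real.dist_eq] at h2
    rw [Function.iterate_succ_apply', Function.iterate_succ_apply']
    have := abs_sub_le (g (g^[i] x)) (f (g^[i] x)) (f (f^[i] x))
    linarith

lemma exists_thickening_mapsTo {F : ℝ → ℝ} (hF : Continuous F)
    (hper : ∀ (x : ℝ) (m : ℤ), F (x + m) = F x + m) {E : Set ℝ} (hE : IsOpen E)
    (hEper : ∀ (x : ℝ) (m : ℤ), x + m ∈ E ↔ x ∈ E) (hmap : ∀ x ∉ E, F x ∈ E) :
    ∃ δ > 0, ∀ x ∉ E, ∀ y, |y - F x| ≤ δ → y ∈ E := by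
  have hK : IsCompact (F '' (Set.Icc 0 1 ∩ Eᶜ)) :=
    (isCompact_Icc.inter_right hE.isClosed_compl).image hF
  obtain ⟨δ, hδ, hsub⟩ := hK.exists_cthickening_subset_open hE (by
    rintro _ ⟨x, hx, rfl⟩; exact hmap x hx.2)
  refine ⟨δ, hδ, fun x hx y hy => ?_⟩
  have hxe : Int.fract x + ⌊x⌋ = x := Int.fract_add_floor x
  have hfr : Int.fract x ∉ E := fun hc => hx (by rw [← hxe]; exact (hEper _ _).2 hc)
  have hFx : F x = F (Int.fract x) + ⌊x⌋ := by rw [← hper, hxe]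
  have : y - ⌊x⌋ ∈ E := hsub <| Metric.mem_cthickening_of_dist_le _ _ _ _
    (Set.mem_image_of_mem F ⟨⟨Int.fract_nonneg x, (Int.fract_lt_one x).le⟩, hfr⟩) (by
      rw [Real.dist_eq]; rw [hFx] at hy; convert hy using 2; ring)
  simpa using (hEper _ ⌊x⌋).2 this

lemma abs_sub_le_of_abs_deriv_le {f : ℝ → ℝ} (hf : Differentiable ℝ f) {C : ℝ}
    (hC : ∀ x, |deriv f x| ≤ C) (x y : ℝ) : |f x - f y| ≤ C * |x - y| := by
  simpa [Real.norm_eq_abs] using Convex.norm_image_sub_le_of_norm_deriv_le (f := f)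
    (s := Set.univ) (x := y) (y := x) (fun z _ => hf z) (fun z _ => hC z) convex_univ trivial trivial

lemma exists_abs_deriv_le {f : ℝ → ℝ} (hf : ContDiff ℝ (⊤ : ℕ∞) f)
    (hper : ∀ x, f (x + 1) = f x + 1) :
    ∃ K, 1 ≤ K ∧ (∀ x, |deriv f x| ≤ K) ∧ ∀ x y, |f x - f y| ≤ K * |x - y| := by
  obtain ⟨K, hK, h⟩ := exists_hasDerivGrowth hf hper 1
  have h1 : ∀ x, |deriv f x| ≤ K := fun x => by simpa using h 1 le_rfl le_rfl x
  exact ⟨K, hK, h1, abs_sub_le_of_abs_deriv_le (hf.differentiable (by simp)) h1⟩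

lemma uniformContinuous_of_map_add_one {f : ℝ → ℝ} (hf : ContDiff ℝ (⊤ : ℕ∞) f)
    (hper : ∀ x, f (x + 1) = f x + 1) : UniformContinuous f := by
  obtain ⟨K, hK, -, h⟩ := exists_abs_deriv_le hf hper
  rw [Metric.uniformContinuous_iff]
  intro ε hε
  refine ⟨ε / K, by positivity, fun a b hab => ?_⟩
  rw [Real.dist_eq] at *
  calc _ ≤ _ := h _ _
    _ < K * (ε / K) := by gcongr
    _ = ε := by field_simp

lemma IsNormalizedLift.exists_density_stable {h : ℝ ≃ ℝ} (hh : IsNormalizedLift h) (t : ℝ) {ε : ℝ}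
    (hε : 0 < ε) :
    ∃ η > 0, ∀ x y d, |y - conjRot h t x| ≤ η → |d - deriv (conjRot h t) x| ≤ η →
      |deriv h.symm y * d - deriv h.symm x| ≤ ε := by
  obtain ⟨K, hK, hK1, -⟩ := exists_abs_deriv_le (hh.contDiff_conjRot t) (hh.conjRot_add_one t)
  obtain ⟨L, hL, hLg⟩ := exists_hasDerivGrowth hh.contDiff_symm hh.symm.map_add_one 2
  have hφ : ∀ x, |deriv h.symm x| ≤ L := fun x => by simpa using hLg 1 le_rfl (by norm_num) x
  have hφ' : ∀ x, |deriv (deriv h.symm) x| ≤ L ^ 2 := fun x => by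
    simpa [iteratedDeriv_succ] using hLg 2 (by norm_num) le_rfl x
  have hdd : Differentiable ℝ (deriv h.symm) := by
    simpa using hh.contDiff_symm.differentiable_iteratedDeriv 1
      (by exact_mod_cast WithTop.coe_lt_top 1)
  have hlip := abs_sub_le_of_abs_deriv_le hdd hφ'
  have hinv : ∀ x, deriv h.symm (conjRot h t x) * deriv (conjRot h t) x = deriv h.symm x := by
    intro x
    have h1 := (hh.contDiff_symm.differentiable (by simp) (conjRot h t x)).hasDerivAt.comp x
      ((hh.contDiff_conjRot t).differentiable (by simp) x).hasDerivAt
    have h2 := (hh.contDiff_symm.differentiable (by simp) x).hasDerivAt.add_const t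
    have e : h.symm ∘ conjRot h t = fun x => h.symm x + t := by ext; simp [conjRot]
    rw [e] at h1
    exact h1.unique h2
  set C := L ^ 2 * (K + 1) + L with hC
  have hC0 : 0 < C := by positivity
  refine ⟨min 1 (ε / C), by positivity, fun x y d hy hd => ?_⟩
  have hd1 : |d| ≤ K + 1 := by
    have h1 := hd.trans (min_le_left _ _)
    have h2 := abs_sub_abs_le_abs_sub d (deriv (conjRot h t) x)
    linarith [hK1 x]
  have hy' := hy.trans (min_le_right _ _)
  have hd' := hd.trans (min_le_right _ _)
  rw [← hinv x]
  calc |deriv h.symm y * d - deriv h.symm (conjRot h t x) * deriv (conjRot h t) x|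
      = |(deriv h.symm y - deriv h.symm (conjRot h t x)) * d
          + deriv h.symm (conjRot h t x) * (d - deriv (conjRot h t) x)| := by ring_nf
    _ ≤ |deriv h.symm y - deriv h.symm (conjRot h t x)| * |d|
          + |deriv h.symm (conjRot h t x)| * |d - deriv (conjRot h t) x| := by
        rw [← abs_mul, ← abs_mul]; exact abs_add_le _ _
    _ ≤ (L ^ 2 * (ε / C)) * (K + 1) + L * (ε / C) := by
        have := hlip y (conjRot h t x)
        have h3 := hφ (conjRot h t x)
        have h4 : |deriv h.symm y - deriv h.symm (conjRot h t x)| ≤ L ^ 2 * (ε / C) :=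
          this.trans (by gcongr)
        gcongr
    _ = C * (ε / C) := by rw [hC]; ring
    _ = ε := by field_simp

/-- The points whose image under `q · h⁻¹` lies in one of the intervals `(m - ε, m)`, `m ∈ ℤ`. -/
def thinSet (h : ℝ ≃ ℝ) (q : ℕ) (ε : ℝ) : Set ℝ :=
  {x | ∃ m : ℤ, q * h.symm x ∈ Set.Ioo (m - ε) (m : ℝ)}

namespace IsNormalizedLift

variable {h : ℝ ≃ ℝ}

lemma isOpen_thinSet (hh : IsNormalizedLift h) (q : ℕ) (ε : ℝ) : IsOpen (thinSet h q ε) := by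
  have : thinSet h q ε = ⋃ m : ℤ, (fun x => q * h.symm x) ⁻¹' Set.Ioo (m - ε) (m : ℝ) := by
    ext; simp [thinSet]
  rw [this]
  exact isOpen_iUnion fun m =>
    isOpen_Ioo.preimage (continuous_const.mul hh.contDiff_symm.continuous)

lemma add_int_mem_thinSet (hh : IsNormalizedLift h) (q : ℕ) (ε : ℝ) (x : ℝ) (m : ℤ) :
    x + m ∈ thinSet h q ε ↔ x ∈ thinSet h q ε := by
  constructor
  · rintro ⟨n, h1, h2⟩
    rw [hh.symm.map_add_int] at h1 h2
    exact ⟨n - q * m, by push_cast; linarith, by push_cast; linarith⟩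
  · rintro ⟨n, h1, h2⟩
    refine ⟨n + q * m, ?_, ?_⟩ <;> rw [hh.symm.map_add_int] <;> push_cast <;> linarith

lemma volume_thinSet_le (hh : IsNormalizedLift h) {q : ℕ} (hq : (q : ℝ) ≠ 0) {ε K : ℝ}
    (hε : 0 < ε) (hε1 : ε < 1) (hK : ∀ x y, |h x - h y| ≤ K * |x - y|) (k : ℤ) :
    volume (thinSet h q ε ∩ Set.Ioc (k : ℝ) (k + 1)) ≤ ENNReal.ofReal (K * ε) := by
  have hq0 : (0 : ℝ) < q := lt_of_le_of_ne (Nat.cast_nonneg q) hq.symm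
  have hsub : thinSet h q ε ∩ Set.Ioc (k : ℝ) (k + 1) ⊆ ⋃ j ∈ Finset.range q,
      Set.Ioo (h (k + (j + 1 - ε) / q)) (h (k + (j + 1) / q)) := by
    rintro x ⟨⟨m, h1, h2⟩, hk1, hk2⟩
    have hk1' := hh.symm.strictMono hk1
    have hk2' := hh.symm.strictMono.monotone hk2
    rw [hh.symm.map_add_one, hh.symm.map_int] at hk2'
    rw [hh.symm.map_int] at hk1'
    have l1 : (q : ℝ) * k < m := (mul_lt_mul_of_pos_left hk1' hq0).trans h2
    have l2 : (m : ℝ) < q * k + q + 1 := by nlinarith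
    have l1' : (q : ℤ) * k < m := by exact_mod_cast l1
    have l2' : m < (q : ℤ) * k + q + 1 := by exact_mod_cast l2
    obtain ⟨j, hj⟩ := Int.eq_ofNat_of_zero_le (show 0 ≤ m - q * k - 1 by omega)
    have hm : (m : ℝ) = q * k + j + 1 := by
      have : m = q * k + j + 1 := by omega
      exact_mod_cast this
    refine Set.mem_biUnion (x := j) (by simp; omega) ⟨?_, ?_⟩
    · rw [← h.apply_symm_apply x]
      apply hh.strictMono
      rw [← lt_sub_iff_add_lt', div_lt_iff₀ hq0]
      linarith
    · rw [← h.apply_symm_apply x]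
      apply hh.strictMono
      rw [← sub_lt_iff_lt_add', lt_div_iff₀ hq0]
      linarith
  calc _ ≤ _ := measure_mono hsub
    _ ≤ ∑ j ∈ Finset.range q, volume (Set.Ioo (h (k + (j + 1 - ε) / q)) (h (k + (j + 1) / q))) :=
        measure_biUnion_finset_le _ _
    _ ≤ ∑ j ∈ Finset.range q, ENNReal.ofReal (K * (ε / q)) := by
        refine Finset.sum_le_sum fun j _ => ?_
        rw [Real.volume_Ioo]
        refine ENNReal.ofReal_le_ofReal ((le_abs_self _).trans ((hK _ _).trans_eq ?_))
        have : (k : ℝ) + (j + 1) / q - (k + (j + 1 - ε) / q) = ε / q := by field_simp; ring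
        rw [this, abs_of_pos (by positivity)]
    _ = ENNReal.ofReal (K * ε) := by
        rw [Finset.sum_const, Finset.card_range, ← ENNReal.ofReal_nsmul, nsmul_eq_mul]
        congr 1
        field_simp

end IsNormalizedLift

lemma exists_floor_of_notMem_thinSet {h : ℝ ≃ ℝ} {q : ℕ} {ε x : ℝ} (hx : x ∉ thinSet h q ε) :
    ∃ m : ℤ, q * h.symm x ∈ Set.Icc (m : ℝ) (m + 1 - ε) := by
  refine ⟨⌊q * h.symm x⌋, Int.floor_le _, ?_⟩
  by_contra! hc
  exact hx ⟨⌊q * h.symm x⌋ + 1, by push_cast; exact hc, by push_cast; exact Int.lt_floor_add_one _⟩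

lemma deriv_symm_of_notMem_thinSet {h a : ℝ ≃ ℝ} (hh : IsNormalizedLift h)
    (ha : IsNormalizedLift a) {q : ℕ} (hq : (q : ℝ) ≠ 0) {ε : ℝ}
    (hval : ∀ m : ℤ, ∀ y ∈ Set.Icc (m : ℝ) (m + 1 - ε), deriv a.symm y = 1 / 2) {x : ℝ}
    (hx : x ∉ thinSet h q ε) :
    2 * deriv ((coverLift q a hq).trans h).symm x = deriv h.symm x := by
  obtain ⟨m, hm⟩ := exists_floor_of_notMem_thinSet hx
  have h1 := (hh.contDiff_symm.differentiable (by simp) x).hasDerivAt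
  have h2 := (ha.contDiff_symm.differentiable (by simp) (q * h.symm x)).hasDerivAt
  have h3 := (h2.comp x (h1.const_mul (q : ℝ))).div_const (q : ℝ)
  have e : (((coverLift q a hq).trans h).symm : ℝ → ℝ)
      = fun x => (a.symm ∘ fun x => q * h.symm x) x / q := by
    ext; simp [coverLift]
  rw [e, h3.deriv, hval m _ hm]
  field_simp

lemma exists_iterate_mem_thinSet {α : ℝ} (hα : Irrational α) {h a : ℝ ≃ ℝ}
    (ha : IsNormalizedLift a) {q : ℕ} (hq : (q : ℝ) ≠ 0) {ε : ℝ} (hε : 0 < ε) (hε1 : ε < 1)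
    (hval : ∀ m : ℤ, ∀ y ∈ Set.Icc (m : ℝ) (m + 1 - ε), a.symm y = m + (y - m) / 2) :
    ∃ i : ℕ, ∀ x ∉ thinSet h q ε,
      (conjRot ((coverLift q a hq).trans h) α)^[i] x ∈ thinSet h q ε := by
  have hβ : Irrational (q * α) := hα.natCast_mul (by exact_mod_cast hq)
  obtain ⟨i, l, hlo, hhi⟩ := exists_nat_mul_sub_int_mem_Ioo hβ
    (show (1 - ε) / 2 < (1 + ε) / 2 by linarith)
  refine ⟨i, fun x hx => ?_⟩
  obtain ⟨m, hm⟩ := exists_floor_of_notMem_thinSet hx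
  have hb := hval m _ hm
  refine ⟨m + l + 1, ?_⟩
  rw [IsNormalizedLift.conjRot_iterate]
  have e : q * h.symm (((coverLift q a hq).trans h)
      (((coverLift q a hq).trans h).symm x + i * α))
      = a (a.symm (q * h.symm x) + i * (q * α)) := by
    simp [coverLift, mul_add, mul_div_cancel₀ _ hq]
    ring_nf
  rw [e, hb]
  have h1 := hval (m + l) (m + l + 1 - ε) (by push_cast; constructor <;> linarith)
  have h2 := ha.symm.map_int (m + l + 1)
  push_cast at h1 h2 ⊢
  constructor
  · rw [← a.apply_symm_apply ((m : ℝ) + l + 1 - ε)]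
    apply ha.strictMono
    rw [h1]
    linarith [hm.1]
  · rw [← a.apply_symm_apply ((m : ℝ) + l + 1)]
    apply ha.strictMono
    rw [h2]
    linarith [hm.2]

lemma exists_next_conjugation {α : ℝ} (hα : Liouville α) {h : ℝ ≃ ℝ} (hh : IsNormalizedLift h)
    {η : ℝ} (hη : 0 < η) (N n : ℕ) :
    ∃ (h' : ℝ ≃ ℝ) (η' : ℝ), IsNormalizedLift h' ∧ 0 < η' ∧ η' ≤ η / 2 ∧
      (∀ t, t = α ∨ t = -α → ∀ k ≤ N, ∀ x,
        |iteratedDeriv k (fun x => conjRot h' t x - conjRot h t x) x| ≤ η / 2) ∧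
      ∃ (E : Set ℝ) (i : ℕ), IsOpen E ∧ (∀ (x : ℝ) (m : ℤ), x + m ∈ E ↔ x ∈ E) ∧
        (∀ k : ℤ, volume (E ∩ Set.Ioc (k : ℝ) (k + 1)) ≤ ENNReal.ofReal ((1 / 2) ^ n)) ∧
        (∀ x ∉ E, 2 * deriv h'.symm x = deriv h.symm x) ∧
        (∀ g : ℝ → ℝ, (∀ x, |g x - conjRot h' α x| ≤ η') → ∀ x ∉ E, g^[i] x ∈ E) ∧
        ∀ x y d, |y - conjRot h' α x| ≤ η' → |d - deriv (conjRot h' α) x| ≤ η' →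
          |deriv h'.symm y * d - deriv h'.symm x| ≤ (1 / 4) ^ n := by
  obtain ⟨K, hK, -, hlip⟩ := exists_abs_deriv_le hh.contDiff hh.map_add_one
  set ε : ℝ := min (1 / 2) ((1 / 2) ^ n / K) with hεdef
  have hε : 0 < ε := by positivity
  have hε1 : ε < 1 := (min_le_left _ _).trans_lt (by norm_num)
  obtain ⟨a, ha, hval⟩ := exists_contracting_lift hε hε1
  obtain ⟨q, hq, hclose⟩ := exists_coverLift_close hα hh ha N (half_pos hη)
  set h' := (coverLift q a hq).trans h with hh'
  have hN : IsNormalizedLift h' := (ha.coverLift q hq).trans hh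
  obtain ⟨i, hi⟩ := exists_iterate_mem_thinSet (h := h) hα.irrational ha hq hε hε1
    fun m y hy => (hval m y hy).1
  have hper : ∀ (x : ℝ) (m : ℤ), (conjRot h' α)^[i] (x + m) = (conjRot h' α)^[i] x + m := by
    intro x m
    rw [IsNormalizedLift.conjRot_iterate, IsNormalizedLift.conjRot_iterate, hN.symm.map_add_int,
      add_right_comm, hN.map_add_int]
  obtain ⟨δ, hδ, hstab⟩ := exists_thickening_mapsTo
    ((hN.contDiff_conjRot α).continuous.iterate i) hper (hh.isOpen_thinSet q ε)
    (hh.add_int_mem_thinSet q ε) hi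
  obtain ⟨η₁, hη₁, h1⟩ := exists_iterate_close
    (uniformContinuous_of_map_add_one (hN.contDiff_conjRot α) (hN.conjRot_add_one α)) i δ hδ
  obtain ⟨η₂, hη₂, h2⟩ := hN.exists_density_stable α (show (0 : ℝ) < (1 / 4) ^ n by positivity)
  refine ⟨h', min (η / 2) (min η₁ η₂), hN, by positivity, min_le_left _ _, hclose,
    thinSet h q ε, i, hh.isOpen_thinSet q ε, hh.add_int_mem_thinSet q ε, fun k => ?_,
    fun x hx => deriv_symm_of_notMem_thinSet hh ha hq (fun m y hy => (hval m y hy).2) hx,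
    fun g hg x hx => hstab x hx _ (h1 g (fun x => (hg x).trans
      ((min_le_right _ _).trans (min_le_left _ _))) x),
    fun x y d hy hd => h2 x y d (hy.trans ((min_le_right _ _).trans (min_le_right _ _)))
      (hd.trans ((min_le_right _ _).trans (min_le_right _ _)))⟩
  refine (hh.volume_thinSet_le hq hε hε1 hlip k).trans (ENNReal.ofReal_le_ofReal ?_)
  calc K * ε ≤ K * ((1 / 2) ^ n / K) := by gcongr; exact min_le_right _ _
    _ = (1 / 2) ^ n := by field_simp

lemma tendsto_zero_of_halving {η : ℕ → ℝ} (hη0 : ∀ n, 0 < η n) (hη : ∀ n, η (n + 1) ≤ η n / 2) :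
    Tendsto η atTop (𝓝 0) := by
  have h : ∀ n, η n ≤ η 0 * (1 / 2) ^ n := by
    intro n
    induction n with
    | zero => simp
    | succ n ih => rw [pow_succ]; linarith [hη n]
  refine squeeze_zero (fun n => (hη0 n).le) h ?_
  simpa using (tendsto_pow_atTop_nhds_zero_of_lt_one (r := (1 / 2 : ℝ)) (by norm_num)
    (by norm_num)).const_mul (η 0)

lemma tendsto_of_abs_sub_le {η : ℕ → ℝ} (hη : Tendsto η atTop (𝓝 0)) {u : ℕ → ℝ} {a : ℝ}
    (h : ∀ n, |a - u n| ≤ η n) : Tendsto u atTop (𝓝 a) := by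
  rw [tendsto_iff_dist_tendsto_zero]
  refine squeeze_zero (fun _ => dist_nonneg) (fun n => ?_) hη
  rw [dist_comm, Real.dist_eq]
  exact h n

/-- Smooth functions whose successive differences decay geometrically, with control of more and
more derivatives, converge to a smooth function. -/
lemma exists_smooth_limit {F : ℕ → ℝ → ℝ} (hF : ∀ n, ContDiff ℝ (⊤ : ℕ∞) (F n)) {η : ℕ → ℝ}
    (hη : ∀ n, η (n + 1) ≤ η n / 2) {R : ℕ}
    (hd : ∀ n, ∀ k ≤ n + R, ∀ x, |iteratedDeriv k (fun x => F (n + 1) x - F n x) x| ≤ η n / 2) :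
    ∃ f : ℝ → ℝ, ContDiff ℝ (⊤ : ℕ∞) f ∧
      ∀ m, ∀ k ≤ m + R, ∀ x, |iteratedDeriv k (fun x => f x - F m x) x| ≤ η m := by
  have hη' : ∀ m n, η (m + n) / 2 ≤ η m / 2 / 2 ^ n := by
    intro m n
    induction n with
    | zero => simp
    | succ n ih =>
      rw [pow_succ, ← div_div, ← add_assoc]
      linarith [hη (m + n)]
  let u : ℕ → ℕ → ℝ → ℝ := fun m n x => F (m + n + 1) x - F (m + n) x
  have hu : ∀ m n, ContDiff ℝ (⊤ : ℕ∞) (u m n) := fun m n => (hF _).sub (hF _)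
  have hbd : ∀ m k n x, k ≤ m + R → ‖iteratedFDeriv ℝ k (u m n) x‖ ≤ η m / 2 / 2 ^ n := by
    intro m k n x hk
    rw [norm_iteratedFDeriv_eq_norm_iteratedDeriv]
    exact (hd (m + n) k (by omega) x).trans (hη' m n)
  have hsum : ∀ m, HasSum (fun n => η m / 2 / 2 ^ n) (η m) := fun m => hasSum_geometric_two' (η m)
  have hcd : ∀ m, ContDiff ℝ ((m + R : ℕ) : ℕ∞) fun x => ∑' n, u m n x := fun m =>
    contDiff_tsum (v := fun _ n => η m / 2 / 2 ^ n) (fun n => (hu m n).of_le (by exact_mod_cast le_top))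
      (fun _ _ => (hsum m).summable) (fun k n x hk => hbd m k n x (by exact_mod_cast hk))
  have htel : ∀ m x, F 0 x + ∑' n, u 0 n x = F m x + ∑' n, u m n x := by
    intro m x
    have hs : Summable fun n => u 0 n x := by
      refine Summable.of_norm_bounded (hsum 0).summable fun n => ?_
      simpa using hbd 0 0 n x (Nat.zero_le _)
    rw [← hs.sum_add_tsum_nat_add m]
    have h1 : ∑ i ∈ Finset.range m, u 0 i x = F m x - F 0 x := by
      simpa [u] using Finset.sum_range_sub (fun i => F i x) m
    have h2 : ∀ i, u 0 (i + m) x = u m i x := fun i => by simp [u, add_comm]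
    simp only [h1, h2]
    ring
  refine ⟨fun x => F 0 x + ∑' n, u 0 n x, ?_, fun m k hk x => ?_⟩
  · rw [contDiff_infty]
    intro m
    simp_rw [htel m]
    exact ((hF m).of_le (by exact_mod_cast le_top)).add
      ((hcd m).of_le (by exact_mod_cast Nat.le_add_right m R))
  · simp_rw [htel m, add_sub_cancel_left]
    rw [← Real.norm_eq_abs, ← norm_iteratedFDeriv_eq_norm_iteratedDeriv,
      iteratedFDeriv_tsum_apply (N := ((m + R : ℕ) : ℕ∞)) (v := fun _ n => η m / 2 / 2 ^ n)
      (fun n => (hu m n).of_le (by exact_mod_cast le_top)) (fun _ _ => (hsum m).summable)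
      (fun k n x hk => hbd m k n x (by exact_mod_cast hk)) (by exact_mod_cast hk)]
    exact tsum_of_norm_bounded (hsum m) fun n => hbd m k n x hk

/-- The iterative construction: a sequence of conjugations, of tolerances, of thin open sets and
of times. -/
lemma exists_conjugation_sequence {α : ℝ} (hα : Liouville α) {η₀ : ℝ} (hη₀ : 0 < η₀) (R : ℕ) :
    ∃ (H : ℕ → ℝ ≃ ℝ) (η : ℕ → ℝ) (E : ℕ → Set ℝ) (i : ℕ → ℕ),
      (∀ n, IsNormalizedLift (H n)) ∧ (∀ n, 0 < η n) ∧ H 0 = Equiv.refl ℝ ∧ η 0 = η₀ ∧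
      (∀ n, η (n + 1) ≤ η n / 2) ∧
      (∀ n t, t = α ∨ t = -α → ∀ k ≤ n + R, ∀ x,
        |iteratedDeriv k (fun x => conjRot (H (n + 1)) t x - conjRot (H n) t x) x| ≤ η n / 2) ∧
      (∀ n, IsOpen (E n)) ∧ (∀ n (x : ℝ) (m : ℤ), x + m ∈ E n ↔ x ∈ E n) ∧
      (∀ n (k : ℤ), volume (E n ∩ Set.Ioc (k : ℝ) (k + 1)) ≤ ENNReal.ofReal ((1 / 2) ^ n)) ∧
      (∀ n, ∀ x ∉ E n, 2 * deriv (H (n + 1)).symm x = deriv (H n).symm x) ∧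
      (∀ n (g : ℝ → ℝ), (∀ x, |g x - conjRot (H (n + 1)) α x| ≤ η (n + 1)) →
        ∀ x ∉ E n, g^[i n] x ∈ E n) ∧
      ∀ n x y d, |y - conjRot (H (n + 1)) α x| ≤ η (n + 1) →
        |d - deriv (conjRot (H (n + 1)) α) x| ≤ η (n + 1) →
        |deriv (H (n + 1)).symm y * d - deriv (H (n + 1)).symm x| ≤ (1 / 4) ^ n := by
  let S := {p : (ℝ ≃ ℝ) × ℝ // IsNormalizedLift p.1 ∧ 0 < p.2}
  have step : ∀ (n : ℕ) (s : S), ∃ (s' : S) (E : Set ℝ) (i : ℕ), s'.1.2 ≤ s.1.2 / 2 ∧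
      (∀ t, t = α ∨ t = -α → ∀ k ≤ n + R, ∀ x,
        |iteratedDeriv k (fun x => conjRot s'.1.1 t x - conjRot s.1.1 t x) x| ≤ s.1.2 / 2) ∧
      IsOpen E ∧ (∀ (x : ℝ) (m : ℤ), x + m ∈ E ↔ x ∈ E) ∧
      (∀ k : ℤ, volume (E ∩ Set.Ioc (k : ℝ) (k + 1)) ≤ ENNReal.ofReal ((1 / 2) ^ n)) ∧
      (∀ x ∉ E, 2 * deriv s'.1.1.symm x = deriv s.1.1.symm x) ∧
      (∀ g : ℝ → ℝ, (∀ x, |g x - conjRot s'.1.1 α x| ≤ s'.1.2) → ∀ x ∉ E, g^[i] x ∈ E) ∧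
      ∀ x y d, |y - conjRot s'.1.1 α x| ≤ s'.1.2 → |d - deriv (conjRot s'.1.1 α) x| ≤ s'.1.2 →
        |deriv s'.1.1.symm y * d - deriv s'.1.1.symm x| ≤ (1 / 4) ^ n := by
    intro n s
    obtain ⟨h', η', h1, h2, h3, h4, E, i, h5⟩ :=
      exists_next_conjugation hα s.2.1 s.2.2 (n + R) n
    exact ⟨⟨(h', η'), h1, h2⟩, E, i, h3, h4, h5⟩
  choose nxt E i h using step
  let s : ℕ → S := fun n => Nat.rec ⟨(Equiv.refl ℝ, η₀), IsNormalizedLift.refl, hη₀⟩ nxt n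
  refine ⟨fun n => (s n).1.1, fun n => (s n).1.2, fun n => E n (s n), fun n => i n (s n),
    fun n => (s n).2.1, fun n => (s n).2.2, rfl, rfl, fun n => (h n (s n)).1,
    fun n => (h n (s n)).2.1, fun n => (h n (s n)).2.2.1, fun n => (h n (s n)).2.2.2.1,
    fun n => (h n (s n)).2.2.2.2.1, fun n => (h n (s n)).2.2.2.2.2.1,
    fun n => (h n (s n)).2.2.2.2.2.2.1, fun n => (h n (s n)).2.2.2.2.2.2.2⟩

lemma IsNormalizedLift.tendsto_iterate_div {f : ℝ → ℝ} {H : ℕ → ℝ ≃ ℝ}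
    (hH : ∀ n, IsNormalizedLift (H n)) {η : ℕ → ℝ} (hη : Tendsto η atTop (𝓝 0)) {α : ℝ}
    (hf : UniformContinuous f) (hfH : ∀ n x, |f x - conjRot (H n) α x| ≤ η n) :
    Tendsto (fun n : ℕ => f^[n] 0 / (n : ℝ)) atTop (𝓝 α) := by
  have key : ∀ m : ℕ, |f^[m] 0 - m * α| ≤ 1 := by
    intro m
    refine le_of_forall_pos_le_add fun δ hδ => ?_
    obtain ⟨ρ, hρ, h⟩ := exists_iterate_close hf m δ hδ
    obtain ⟨n, hn⟩ := (hη.eventually_lt_const hρ).exists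
    have h1 := h (conjRot (H n) α) (fun x => by
      rw [abs_sub_comm]; exact (hfH n x).trans hn.le) 0
    rw [conjRot_iterate, (hH n).symm.map_zero, zero_add, abs_sub_comm] at h1
    have h2 := (hH n).abs_sub_le_one (m * α)
    linarith [abs_sub_le (f^[m] 0) (H n (m * α)) (m * α)]
  rw [tendsto_iff_dist_tendsto_zero]
  refine squeeze_zero' (.of_forall fun _ => dist_nonneg) ?_ tendsto_one_div_atTop_nhds_zero_nat
  filter_upwards [eventually_gt_atTop 0] with m hm
  have hm' : (0 : ℝ) < m := by exact_mod_cast hm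
  rw [Real.dist_eq, show f^[m] 0 / (m : ℝ) - α = (f^[m] 0 - m * α) / m by field_simp,
    abs_div, abs_of_pos hm']
  gcongr
  exact key m

/-- Uniform limits of conjugates of the translations by `t` and `-t` are mutually inverse. -/
lemma leftInverse_of_conjRot_limit {f g : ℝ → ℝ} {H : ℕ → ℝ ≃ ℝ} {η : ℕ → ℝ}
    (hη : Tendsto η atTop (𝓝 0)) {t : ℝ} (hg : Continuous g)
    (hfH : ∀ n x, |f x - conjRot (H n) t x| ≤ η n) (hgH : ∀ n x, |g x - conjRot (H n) (-t) x| ≤ η n) :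
    Function.LeftInverse g f := by
  intro x
  have h1 := (hg.tendsto _).comp (tendsto_of_abs_sub_le hη fun n => hfH n x)
  refine tendsto_nhds_unique h1 (tendsto_of_abs_sub_le hη fun n => ?_)
  have := hgH n (conjRot (H n) t x)
  rw [abs_sub_comm]
  simpa [conjRot] using this

lemma map_add_one_of_conjRot_limit {f : ℝ → ℝ} {H : ℕ → ℝ ≃ ℝ}
    (hH : ∀ n, IsNormalizedLift (H n)) {η : ℕ → ℝ} (hη : Tendsto η atTop (𝓝 0)) {t : ℝ}
    (hfH : ∀ n x, |f x - conjRot (H n) t x| ≤ η n) (x : ℝ) : f (x + 1) = f x + 1 := by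
  have h : ∀ x, Tendsto (fun n => conjRot (H n) t x) atTop (𝓝 (f x)) := fun x =>
    tendsto_of_abs_sub_le hη fun n => hfH n x
  refine tendsto_nhds_unique (h (x + 1)) ?_
  simp_rw [(hH _).conjRot_add_one]
  exact (h x).add_const 1

lemma monotone_of_conjRot_limit {f : ℝ → ℝ} {H : ℕ → ℝ ≃ ℝ}
    (hH : ∀ n, IsNormalizedLift (H n)) {η : ℕ → ℝ} (hη : Tendsto η atTop (𝓝 0)) {t : ℝ}
    (hfH : ∀ n x, |f x - conjRot (H n) t x| ≤ η n) : Monotone f := by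
  have h : ∀ x, Tendsto (fun n => conjRot (H n) t x) atTop (𝓝 (f x)) := fun x =>
    tendsto_of_abs_sub_le hη fun n => hfH n x
  intro x y hxy
  exact le_of_tendsto_of_tendsto' (h x) (h y) fun n =>
    (hH n).strictMono.monotone (by simpa using (hH n).symm.strictMono.monotone hxy)

lemma deriv_pos_of_monotone_of_leftInverse {f g : ℝ → ℝ} (hf : Differentiable ℝ f)
    (hg : Differentiable ℝ g) (hm : Monotone f) (hgf : Function.LeftInverse g f) (x : ℝ) :
    0 < deriv f x := by
  have h1 := (hg (f x)).hasDerivAt.comp x (hf x).hasDerivAt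
  rw [hgf.comp_eq_id] at h1
  have h2 := h1.unique (hasDerivAt_id x)
  refine lt_of_le_of_ne hm.deriv_nonneg fun h0 => ?_
  rw [← h0] at h2
  simp at h2

lemma CrNorm_le {r : ℕ} {φ : ℝ → ℝ} {C : ℝ} (h : ∀ k ≤ r, ∀ x, |iteratedDeriv k φ x| ≤ C) :
    CrNorm r φ ≤ C :=
  Finset.sup'_le _ _ fun k hk => ciSup_le (h k (by simpa [Nat.lt_succ_iff] using hk))

lemma liftDist_le {r : ℕ} {f g : ℝ → ℝ} (hgf : Function.LeftInverse g f)
    (hfg : Function.LeftInverse f g) {α C : ℝ}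
    (hf : ∀ k ≤ r, ∀ x, |iteratedDeriv k (fun x => f x - (x + α)) x| ≤ C)
    (hg : ∀ k ≤ r, ∀ x, |iteratedDeriv k (fun x => g x - (x + -α)) x| ≤ C) :
    liftDist r f (RotLift α) ≤ C := by
  have h1 : Function.invFun f = g := by
    ext x
    apply hgf.injective
    rw [Function.invFun_eq ⟨g x, hfg x⟩, hfg]
  have h2 : Function.invFun (RotLift α) = fun x => x + -α := by
    ext x
    have : RotLift α (Function.invFun (RotLift α) x) = x :=
      Function.invFun_eq ⟨x + -α, by simp [RotLift]⟩
    simp only [RotLift] at this ⊢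
    linarith
  rw [liftDist, h1, h2]
  exact max_le (CrNorm_le hf) (CrNorm_le hg)

/-- A finite invariant measure vanishes if some iterates push the complements of a summable
sequence of sets into these sets. -/
lemma measure_univ_eq_zero_of_mapsTo_compl {X : Type*} [MeasurableSpace X] {μ ν : Measure X}
    [IsFiniteMeasure ν] (hν : ν ≪ μ) {F : X → X} (hF : Measurable F) (hinv : Measure.map F ν = ν)
    {A : ℕ → Set X} (hA : ∀ n, MeasurableSet (A n)) (hsum : ∑' n, μ (A n) ≠ ⊤) {i : ℕ → ℕ}
    (hmap : ∀ n, ∀ z ∉ A n, F^[i n] z ∈ A n) : ν Set.univ = 0 := by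
  have h1 : ∀ᵐ z ∂ν, ∀ᶠ n in atTop, z ∉ A n := hν.ae_le (ae_eventually_notMem hsum)
  have h2 : Tendsto (fun n => ν (A n)) atTop (𝓝 (ν ∅)) := by
    refine tendsto_measure_of_ae_tendsto_indicator_of_isFiniteMeasure atTop .empty hA ?_
    filter_upwards [h1] with z hz
    filter_upwards [hz] with n hn
    simpa using hn
  have h3 : ∀ n, ν Set.univ ≤ 2 * ν (A n) := by
    intro n
    have hF' : MeasurePreserving F ν ν := ⟨hF, hinv⟩
    have h4 : ν (A n)ᶜ ≤ ν (A n) :=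
      (measure_mono (fun z hz => hmap n z hz)).trans_eq
        ((hF'.iterate (i n)).measure_preimage (hA n).nullMeasurableSet)
    rw [← measure_add_measure_compl (hA n), two_mul]
    gcongr
  rw [measure_empty] at h2
  have h5 := ENNReal.Tendsto.const_mul (a := 2) h2 (Or.inr (by simp))
  rw [mul_zero] at h5
  exact le_antisymm (ge_of_tendsto' h5 h3) bot_le

lemma ae_real_of_ae_circle {P : UnitAddCircle → Prop} (h : ∀ᵐ z, P z) : ∀ᵐ x : ℝ, P x := by
  have h1 : ∀ k : ℤ, ∀ᵐ x : ℝ ∂(volume.restrict (Set.Ioc (k : ℝ) (k + 1))), P x := fun k =>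
    (UnitAddCircle.measurePreserving_mk k).quasiMeasurePreserving.ae h
  rw [← ae_restrict_iUnion_iff, iUnion_Ioc_intCast, Measure.restrict_univ] at h1
  exact h1

lemma ae_circle_of_ae_real {P : UnitAddCircle → Prop} (hP : MeasurableSet {z | P z})
    (h : ∀ᵐ x : ℝ, P x) : ∀ᵐ z, P z := by
  have h1 := UnitAddCircle.measurePreserving_mk 0
  rw [← h1.map_eq, ae_map_iff h1.measurable.aemeasurable hP]
  exact ae_restrict_of_ae h

lemma exists_circle_set {E : Set ℝ} (hE : IsOpen E)
    (hper : ∀ (x : ℝ) (m : ℤ), x + m ∈ E ↔ x ∈ E) :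
    ∃ A : Set UnitAddCircle, IsOpen A ∧ (∀ x : ℝ, (x : UnitAddCircle) ∈ A ↔ x ∈ E) ∧
      volume A = volume (E ∩ Set.Ioc 0 1) := by
  have hp : Function.Periodic (fun x => x ∈ E) (1 : ℝ) := fun x => by simpa using hper x 1
  let A : Set UnitAddCircle := {z | hp.lift z}
  have hA : IsOpen A := by
    exact isQuotientMap_quotient_mk'.isOpen_preimage.1 hE
  refine ⟨A, hA, fun x => Iff.rfl, ?_⟩
  rw [← (UnitAddCircle.measurePreserving_mk 0).measure_preimage hA.measurableSet.nullMeasurableSet,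
    zero_add]
  exact Measure.restrict_apply hE.measurableSet

lemma exists_circle_map {f : ℝ → ℝ} (hf : Continuous f) (hper : ∀ x, f (x + 1) = f x + 1) :
    ∃ F : UnitAddCircle → UnitAddCircle, Continuous F ∧ ∀ x : ℝ, F x = f x := by
  have hp : Function.Periodic (fun x => (f x : UnitAddCircle)) 1 := fun x => by
    simp [hper]
  refine ⟨hp.lift, ?_, fun x => rfl⟩
  exact ((AddCircle.continuous_mk' 1).comp hf).quotient_lift _

lemma exists_circle_fun {w : ℝ → ℝ} (hw : Continuous w) (hp : Function.Periodic w 1) :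
    ∃ W : UnitAddCircle → ℝ, Continuous W ∧ ∀ x : ℝ, W x = w x :=
  ⟨hp.lift, hw.quotient_lift _, fun _ => rfl⟩

lemma map_withDensity_eq_of_ae {f g : ℝ → ℝ} (hf : IsCircleDiffeoLift f)
    (hfg : Function.LeftInverse f g) {F : UnitAddCircle → UnitAddCircle} (hFm : Measurable F)
    (hF : ∀ x : ℝ, F x = f x) {ρ : UnitAddCircle → ENNReal}
    (h : ∀ᵐ x : ℝ, ENNReal.ofReal (deriv f x) * ρ (f x : ℝ) = ρ x) :
    Measure.map F (volume.withDensity ρ) = volume.withDensity ρ := by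
  obtain ⟨hfs, hper, hpos⟩ := hf
  have hmono := strictMono_of_deriv_pos hpos
  have himg : f '' Set.Ioc 0 (0 + 1) = Set.Ioc (f 0) (f 0 + 1) := by
    ext y
    constructor
    · rintro ⟨x, hx, rfl⟩
      rw [← hper]
      exact ⟨hmono hx.1, hmono.monotone hx.2⟩
    · intro hy
      refine ⟨g y, ⟨?_, ?_⟩, hfg y⟩
      · rw [← hmono.lt_iff_lt, hfg]; exact hy.1
      · rw [← hmono.le_iff_le, hfg, hper]; exact hy.2
  ext A hA
  rw [Measure.map_apply hFm hA, withDensity_apply _ hA, withDensity_apply _ (hFm hA),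
    ← lintegral_indicator hA, ← lintegral_indicator (hFm hA),
    ← UnitAddCircle.lintegral_preimage 0, ← UnitAddCircle.lintegral_preimage (f 0), ← himg,
    lintegral_image_eq_lintegral_abs_deriv_mul measurableSet_Ioc
      (fun x _ => (hfs.differentiable (by simp) x).hasDerivAt.hasDerivWithinAt)
      hmono.injective.injOn]
  refine lintegral_congr_ae (ae_restrict_of_ae ?_)
  filter_upwards [h] with x hx
  rw [abs_of_pos (hpos x)]
  by_cases hxA : (f x : UnitAddCircle) ∈ A
  · rw [Set.indicator_of_mem hxA, Set.indicator_of_mem (by simpa [hF] using hxA), hx]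
  · rw [Set.indicator_of_notMem hxA, Set.indicator_of_notMem (by simpa [hF] using hxA), mul_zero]

lemma ae_comp_of_leftInverse {f g : ℝ → ℝ} (hgf : Function.LeftInverse g f)
    (hg : Differentiable ℝ g) {P : ℝ → Prop} (h : ∀ᵐ x, P x) : ∀ᵐ x, P (f x) := by
  rw [ae_iff] at h ⊢
  refine measure_mono_null ?_
    (addHaar_image_eq_zero_of_differentiableOn_of_addHaar_eq_zero volume (f := g)
      hg.differentiableOn h)
  exact fun x hx => ⟨f x, hx, hgf x⟩

lemma exists_eventually_eq_const {w : ℕ → ℝ} (hpos : ∀ n, 0 < w n)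
    (h : ∀ᶠ n in atTop, w (n + 1) = w n) : ∃ c, 0 < c ∧ ∀ᶠ n in atTop, w n = c := by
  obtain ⟨N, hN⟩ := eventually_atTop.1 h
  refine ⟨w N, hpos N, eventually_atTop.2 ⟨N, fun n hn => ?_⟩⟩
  induction n, hn using Nat.le_induction with
  | base => rfl
  | succ n hn ih => rw [hN n hn, ih]

/-- A sequence of positive densities that is almost everywhere eventually constant and
asymptotically invariant under a circle diffeomorphism yields an invariant σ-finite measure
equivalent to Lebesgue measure. -/
lemma exists_invariant_measure {f g : ℝ → ℝ} (hf : IsCircleDiffeoLift f)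
    (hfg : Function.LeftInverse f g) (hg : Differentiable ℝ g)
    {F : UnitAddCircle → UnitAddCircle} (hFm : Measurable F) (hF : ∀ x : ℝ, F x = f x)
    {w : ℕ → ℝ → ℝ} (hw : ∀ n, Continuous (w n)) (hper : ∀ n, Function.Periodic (w n) 1)
    (hpos : ∀ n x, 0 < w n x) (hconst : ∀ᵐ x, ∀ᶠ n in atTop, w (n + 1) x = w n x)
    (hinv : ∀ x, Tendsto (fun n => w n (f x) * deriv f x - w n x) atTop (𝓝 0)) :
    ∃ μ : Measure UnitAddCircle, SigmaFinite μ ∧ Measure.map F μ = μ ∧ μ ≪ volume ∧ volume ≪ μ := by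
  have hgf : Function.LeftInverse g f :=
    hfg.rightInverse_of_injective (strictMono_of_deriv_pos hf.2.2).injective
  choose W hWc hW using fun n => exists_circle_fun (hw n) (hper n)
  let ρ : UnitAddCircle → ENNReal := fun z => limsup (fun n => ENNReal.ofReal (W n z)) atTop
  have hρm : Measurable ρ := Measurable.limsup fun n => (hWc n).measurable.ennreal_ofReal
  have hρ : ∀ (x c : ℝ), (∀ᶠ n in atTop, w n x = c) → ρ x = ENNReal.ofReal c := by
    intro x c h
    refine (Tendsto.congr' ?_ tendsto_const_nhds).limsup_eq
    filter_upwards [h] with n hn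
    rw [hW, hn]
  have hlim : ∀ᵐ x : ℝ, ∃ c, 0 < c ∧ ∀ᶠ n in atTop, w n x = c := by
    filter_upwards [hconst] with x hx
    exact exists_eventually_eq_const (fun n => hpos n x) hx
  have hρ' : ∀ᵐ z, ρ z ≠ 0 ∧ ρ z ≠ ⊤ := by
    refine ae_circle_of_ae_real ((hρm (measurableSet_singleton 0)).compl.inter
      (hρm (measurableSet_singleton ⊤)).compl) ?_
    filter_upwards [hlim] with x ⟨c, hc, hx⟩
    rw [hρ x c hx]
    exact ⟨by simpa using hc, ENNReal.ofReal_ne_top⟩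
  refine ⟨volume.withDensity ρ, SigmaFinite.withDensity_of_ne_top (hρ'.mono fun z hz => hz.2),
    map_withDensity_eq_of_ae hf hfg hFm hF ?_, withDensity_absolutelyContinuous _ _,
    withDensity_absolutelyContinuous' hρm.aemeasurable (hρ'.mono fun z hz => hz.1)⟩
  filter_upwards [hlim, ae_comp_of_leftInverse hgf hg hlim] with x ⟨c, hc, hx⟩ ⟨d, hd, hfx⟩
  rw [hρ x c hx, hρ _ d hfx, ← ENNReal.ofReal_mul (hf.2.2 x).le]
  congr 1
  have h1 : Tendsto (fun n => w n (f x) * deriv f x - w n x) atTop (𝓝 (d * deriv f x - c)) := by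
    refine Tendsto.congr' ?_ tendsto_const_nhds
    filter_upwards [hx, hfx] with n h1 h2
    rw [h1, h2]
  linarith [tendsto_nhds_unique h1 (hinv x)]

/-- For a Liouville number `α ∈ (0,1)` and any `r`, there is a type `II_∞` smooth circle
diffeomorphism with rotation number `α` whose lift is `2^{-r}`-close to `R_α` in `d_r`. -/
theorem stmt_5 (α : ℝ) (hα0 : 0 < α) (hα1 : α < 1) (hL : Liouville α) (r : ℕ) :
    ∃ f : ℝ → ℝ, IsCircleDiffeoLift f ∧ HasRotationNumber f α ∧
      liftDist r f (RotLift α) < ((2 : ℝ) ^ r)⁻¹ ∧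
      ∃ F : UnitAddCircle → UnitAddCircle, Measurable F ∧
        (∀ x : ℝ, F ↑x = ↑(f x)) ∧
        (∃ μ : Measure UnitAddCircle, SigmaFinite μ ∧ μ Set.univ = ⊤ ∧
          Measure.map F μ = μ ∧ μ ≪ volume ∧ volume ≪ μ) ∧
        ¬ ∃ ν : Measure UnitAddCircle, IsFiniteMeasure ν ∧
          Measure.map F ν = ν ∧ ν ≪ volume ∧ volume ≪ ν := by
  obtain ⟨H, η, E, i, hH, hη0, hH0, hη00, hη, hclose, hEo, hEper, hEvol, hEderiv, hEmap, hdens⟩ :=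
    exists_conjugation_sequence hL (η₀ := ((2 : ℝ) ^ r)⁻¹ / 2) (by positivity) (r + 1)
  have hηlim := tendsto_zero_of_halving hη0 hη
  obtain ⟨f, hf, hfH⟩ := exists_smooth_limit (fun n => (hH n).contDiff_conjRot α) hη
    fun n => hclose n α (Or.inl rfl)
  obtain ⟨g, hg, hgH⟩ := exists_smooth_limit (fun n => (hH n).contDiff_conjRot (-α)) hη
    fun n => hclose n (-α) (Or.inr rfl)
  have hfH0 : ∀ n x, |f x - conjRot (H n) α x| ≤ η n := fun n x => by
    simpa using hfH n 0 (Nat.zero_le _) x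
  have hgH0 : ∀ n x, |g x - conjRot (H n) (-α) x| ≤ η n := fun n x => by
    simpa using hgH n 0 (Nat.zero_le _) x
  have hfH1 : ∀ n x, |deriv f x - deriv (conjRot (H n) α) x| ≤ η n := fun n x => by
    have := hfH n 1 (by omega) x
    rwa [iteratedDeriv_one, deriv_fun_sub (hf.differentiable (by simp) x)
      (((hH n).contDiff_conjRot α).differentiable (by simp) x)] at this
  have hfper := map_add_one_of_conjRot_limit hH hηlim hfH0
  have hgf : Function.LeftInverse g f := leftInverse_of_conjRot_limit hηlim hg.continuous hfH0 hgH0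
  have hfg : Function.LeftInverse f g :=
    leftInverse_of_conjRot_limit hηlim hf.continuous hgH0 (by simpa using hfH0)
  have hdiffeo : IsCircleDiffeoLift f := ⟨hf, hfper,
    deriv_pos_of_monotone_of_leftInverse (hf.differentiable (by simp)) (hg.differentiable (by simp))
      (monotone_of_conjRot_limit hH hηlim hfH0) hgf⟩
  obtain ⟨F, hFc, hF⟩ := exists_circle_map hf.continuous hfper
  have hFiter : ∀ (n : ℕ) (x : ℝ), F^[n] x = (f^[n] x : ℝ) := fun n x =>
    ((show Function.Semiconj ((↑) : ℝ → UnitAddCircle) f F from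
      fun x => (hF x).symm).iterate_right n x).symm
  choose A hAo hA hAvol using fun n => exists_circle_set (hEo n) (hEper n)
  have hAsum : ∑' n, volume (A n) ≠ ⊤ := by
    refine ne_top_of_le_ne_top (b := ∑' n : ℕ, ENNReal.ofReal ((1 / 2) ^ n)) ?_
      (ENNReal.tsum_le_tsum fun n => ?_)
    · exact summable_geometric_two.tsum_ofReal_ne_top
    · rw [hAvol]
      simpa using hEvol n 0
  have hnofinite : ∀ ν : Measure UnitAddCircle, IsFiniteMeasure ν → Measure.map F ν = ν →
      ν ≪ volume → ¬ volume ≪ ν := by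
    intro ν _ hinv hac hca
    have h0 := measure_univ_eq_zero_of_mapsTo_compl hac hFc.measurable hinv
      (fun n => (hAo n).measurableSet) hAsum (i := i) (fun n z => by
        induction z using QuotientAddGroup.induction_on with
        | H x =>
          intro hx
          rw [hFiter, hA]
          exact hEmap n f (hfH0 (n + 1)) x fun h => hx ((hA n x).2 h))
    have := hca h0
    simp at this
  have hclosed : ∀ᵐ x : ℝ, ∀ᶠ n in atTop, x ∉ E n := by
    simpa only [hA] using ae_real_of_ae_circle (ae_eventually_notMem hAsum)
  obtain ⟨μ, hσ, hμinv, hμac, hacμ⟩ := exists_invariant_measure hdiffeo hfg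
    (hg.differentiable (by simp)) hFc.measurable hF (w := fun n x => 2 ^ n * deriv (H n).symm x)
    (fun n => continuous_const.mul ((hH n).contDiff_symm.continuous_deriv (by simp)))
    (fun n x => by
      have := periodic_iteratedDeriv (hH n).symm.map_add_one le_rfl x
      simp only [iteratedDeriv_one] at this
      exact congrArg (2 ^ n * ·) this)
    (fun n x => mul_pos (by positivity) ((hH n).symm.deriv_pos x))
    (by
      filter_upwards [hclosed] with x hx
      filter_upwards [hx] with n hn
      rw [← hEderiv n x hn, pow_succ, mul_assoc])
    (fun x => by
      rw [← tendsto_add_atTop_iff_nat 1]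
      have hpow : Tendsto (fun n : ℕ => 2 * (1 / 2 : ℝ) ^ n) atTop (𝓝 0) := by
        simpa using (tendsto_pow_atTop_nhds_zero_of_lt_one (r := (1 / 2 : ℝ)) (by norm_num)
          (by norm_num)).const_mul 2
      refine squeeze_zero_norm (fun n => ?_) hpow
      have h1 := hdens n x (f x) (deriv f x) (hfH0 (n + 1) x) (hfH1 (n + 1) x)
      rw [mul_assoc, ← mul_sub, norm_mul, Real.norm_eq_abs, Real.norm_eq_abs, abs_of_pos (by positivity)]
      calc (2 : ℝ) ^ (n + 1) * _ ≤ 2 ^ (n + 1) * (1 / 4) ^ n := by gcongr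
        _ = 2 * (1 / 2) ^ n := by
          rw [pow_succ, mul_comm (2 ^ n), mul_assoc, ← mul_pow]; norm_num)
  refine ⟨f, hdiffeo, ⟨0, ?_⟩, ?_, F, hFc.measurable, hF, ⟨μ, hσ, ?_, hμinv, hμac, hacμ⟩, ?_⟩
  · simpa using IsNormalizedLift.tendsto_iterate_div hH hηlim
      (uniformContinuous_of_map_add_one hf hfper) hfH0
  · refine (liftDist_le hgf hfg (C := η 0) (fun k hk x => ?_) (fun k hk x => ?_)).trans_lt ?_
    · simpa [hH0, conjRot] using hfH 0 k (by omega) x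
    · simpa [hH0, conjRot] using hgH 0 k (by omega) x
    · rw [hη00]
      exact half_lt_self (by positivity)
  · by_contra htop
    exact hnofinite μ ⟨lt_top_iff_ne_top.2 htop⟩ hμinv hμac hacμ
  · rintro ⟨ν, h1, h2, h3, h4⟩
    exact hnofinite ν h1 h2 h3 h4
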